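/- Let q ≥ 2 and D = q(q−1)/2. Every two-step nilpotent Lie algebra of type (D−1, q) is an Einstein nilradical. -/

import Mathlib

open LieAlgebra Module LinearMap

/-- A raw inner product on a real vector space: symmetric, bilinear, positive definite. -/
def IsInnerProduct (g : Type*) [AddCommGroup g] [Module ℝ g] (ip : g → g → ℝ) : Prop :=
  (∀ X Y : g, ip X Y = ip Y X) ∧
  (∀ (a : ℝ) (X X' Y : g), ip (a • X + X') Y = a * ip X Y + ip X' Y) ∧
  (∀ X : g, X ≠ 0 → 0 < ip X X)

/-- A basis is orthonormal with respect to a raw inner product. -/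
def IsONB {g : Type*} [AddCommGroup g] [Module ℝ g] {ι : Type}
    (ip : g → g → ℝ) (E : Basis ι ℝ g) : Prop :=
  ∀ i j, (i = j → ip (E i) (E j) = 1) ∧ (i ≠ j → ip (E i) (E j) = 0)

/-- The right hand side of the defining identity for the Ricci operator. -/
noncomputable def ricRHS {g : Type*} [LieRing g] [LieAlgebra ℝ g] {ι : Type} [Fintype ι]
    (ip : g → g → ℝ) (E : Basis ι ℝ g) (A : g →ₗ[ℝ] g) : ℝ :=
  ∑ i, ∑ j, ip (A ⁅E i, E j⁆ - ⁅A (E i), E j⁆ - ⁅E i, A (E j)⁆) ⁅E i, E j⁆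

/-- `n` is a two-step nilpotent Lie algebra of type `(p,q)`: `[[n,n],n] = 0`,
`dim n = p + q` and `dim [n,n] = p`. -/
def IsTwoStepOfType (n : Type*) [LieRing n] [LieAlgebra ℝ n] [FiniteDimensional ℝ n]
    (p q : ℕ) : Prop :=
  (∀ X Y Z : n, ⁅⁅X, Y⁆, Z⁆ = 0) ∧ finrank ℝ n = p + q ∧
    finrank ℝ (derivedSeries ℝ n 1) = p

/-- `n` belongs to the class `O(p,q)`: every derivation with zero trace has zero trace on the
derived algebra `[n,n]`. -/
def InClassO (n : Type*) [LieRing n] [LieAlgebra ℝ n] [FiniteDimensional ℝ n] : Prop :=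
  ∀ (ψ : LieDerivation ℝ n n)
    (h : ∀ x ∈ (derivedSeries ℝ n 1).toSubmodule, (ψ : n →ₗ[ℝ] n) x ∈
      (derivedSeries ℝ n 1).toSubmodule),
    trace ℝ n (ψ : n →ₗ[ℝ] n) = 0 →
    trace ℝ (derivedSeries ℝ n 1).toSubmodule (((ψ : n →ₗ[ℝ] n)).restrict h) = 0

/-- `n` is an Einstein nilradical: it admits an inner product, a derivation `Φ` and a constant
`c < 0` such that `Ric = c·id + Φ`. -/
def IsEinsteinNilradical (n : Type*) [LieRing n] [LieAlgebra ℝ n] [FiniteDimensional ℝ n] :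
    Prop :=
  ∃ ip : n → n → ℝ, IsInnerProduct n ip ∧
    ∃ (Φ : LieDerivation ℝ n n) (c : ℝ), c < 0 ∧
      ∀ (ι : Type) (_ : Fintype ι) (E : Basis ι ℝ n), IsONB ip E →
        ∀ A : n →ₗ[ℝ] n,
          trace ℝ n ((c • LinearMap.id + (Φ : n →ₗ[ℝ] n)) ∘ₗ A) = 4⁻¹ * ricRHS ip E A

/-- Adapted data for a two-step nilpotent Lie algebra of type `(D-1,q)`. -/
structure NilFrame (n : Type) [LieRing n] [LieAlgebra ℝ n] (q : ℕ) where
  X : Fin q → n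
  π : n →ₗ[ℝ] (Fin q → ℝ)
  ω : Matrix (Fin q) (Fin q) ℝ
  πX : ∀ a, π (X a) = Pi.single a 1
  πbr : ∀ x y : n, π ⁅x, y⁆ = 0
  cen : ∀ x y : n, π x = 0 → ⁅x, y⁆ = 0
  skew : ∀ a b, ω b a = - ω a b
  ne : ω ≠ 0
  rel : ∑ a, ∑ b, ω a b • ⁅X a, X b⁆ = 0
  uniq : ∀ M : Matrix (Fin q) (Fin q) ℝ, (∀ a b, M b a = - M a b) →
    ∑ a, ∑ b, M a b • ⁅X a, X b⁆ = 0 → ∃ t : ℝ, M = t • ω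
  surj : ∀ x, π x = 0 → ∃ M : Matrix (Fin q) (Fin q) ℝ, (∀ a b, M b a = - M a b) ∧
    ∑ a, ∑ b, M a b • ⁅X a, X b⁆ = x

/-- Skew matrices. -/
def skewMat (q : ℕ) : Submodule ℝ (Matrix (Fin q) (Fin q) ℝ) where
  carrier := {M | ∀ a b, M b a = - M a b}
  add_mem' := by
    intro M N hM hN a b
    simp only [Matrix.add_apply]
    rw [hM a b, hN a b]; ring
  zero_mem' := by intro a b; simp
  smul_mem' := by
    intro c M hM a b
    simp only [Matrix.smul_apply, smul_eq_mul]
    rw [hM a b]; ring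

/-- Skew matrices are given by their entries below the diagonal. -/
noncomputable def skewEquiv (q : ℕ) :
    skewMat q ≃ₗ[ℝ] ((Σ a : Fin q, Fin (a : ℕ)) → ℝ) where
  toFun M p := M.1 p.1 ⟨p.2, p.2.2.trans p.1.2⟩
  map_add' M N := by ext p; rfl
  map_smul' c M := by ext p; rfl
  invFun f := ⟨fun a b => if h : b < a then f ⟨a, ⟨b, h⟩⟩ else
      if h : a < b then - f ⟨b, ⟨a, h⟩⟩ else 0, by
    intro a b
    rcases lt_trichotomy a b with h | h | h
    · simp [h, h.not_gt]
    · subst h; simp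
    · simp [h, h.not_gt]⟩
  left_inv M := by
    ext a b
    rcases lt_trichotomy a b with h | h | h
    · simp only [h, h.not_gt, dif_pos, dif_neg, not_false_eq_true]
      rw [M.2 a b]; simp
    · subst h
      have := M.2 a a
      simp only [lt_irrefl, dif_neg, not_false_eq_true]
      linarith
    · simp [h]
  right_inv f := by
    ext ⟨a, b⟩
    have : (⟨b, b.2.trans a.2⟩ : Fin q) < a := b.2
    simp [this]

lemma finrank_skewMat (q : ℕ) : finrank ℝ (skewMat q) = q * (q - 1) / 2 := by
  rw [(skewEquiv q).finrank_eq, finrank_fintype_fun_eq_card, Fintype.card_sigma]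
  simp only [Fintype.card_fin]
  rw [Fin.sum_univ_eq_sum_range (fun i => i), Finset.sum_range_id]

lemma bracket_expand {n : Type} [LieRing n] [LieAlgebra ℝ n] {q : ℕ}
    (X : Fin q → n) (π : n →ₗ[ℝ] (Fin q → ℝ)) (πX : ∀ a, π (X a) = Pi.single a 1)
    (cen : ∀ x y : n, π x = 0 → ⁅x, y⁆ = 0) (x y : n) :
    ⁅x, y⁆ = ∑ a, ∑ b, (π x a * π y b) • ⁅X a, X b⁆ := by
  have key : ∀ x : n, π (x - ∑ a, π x a • X a) = 0 := by
    intro x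
    ext b
    simp [map_sum, πX, Pi.single_apply]
  have e1 : ∀ x y : n, ⁅x, y⁆ = ⁅∑ a, π x a • X a, y⁆ := by
    intro x y
    have := cen _ y (key x)
    rwa [sub_lie, sub_eq_zero] at this
  have e2 : ∀ x y : n, ⁅x, y⁆ = ⁅x, ∑ a, π y a • X a⁆ := by
    intro x y
    rw [← lie_skew x y, e1 y x, lie_skew]
  rw [e1, e2]
  simp only [sum_lie, lie_sum, smul_lie, lie_smul, smul_smul, Finset.smul_sum]
  rw [Finset.sum_comm]
  refine Finset.sum_congr rfl fun a _ => Finset.sum_congr rfl fun b _ => ?_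
  rw [mul_comm]

lemma ker_one {V W : Type} [AddCommGroup V] [Module ℝ V] [AddCommGroup W] [Module ℝ W]
    (T : V →ₗ[ℝ] W) (hk : finrank ℝ (LinearMap.ker T) = 1) :
    ∃ w : LinearMap.ker T, w ≠ 0 ∧ ∀ v : LinearMap.ker T, ∃ c : ℝ, c • w = v := by
  obtain ⟨w, hw0, hw⟩ := finrank_eq_one_iff'.1 hk
  exact ⟨w, hw0, hw⟩

lemma exists_frame (q : ℕ) (hq : 2 ≤ q)
    (n : Type) [LieRing n] [LieAlgebra ℝ n] [FiniteDimensional ℝ n]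
    (h2 : IsTwoStepOfType n (q * (q - 1) / 2 - 1) q) :
    Nonempty (NilFrame n q) := by
  obtain ⟨hn, hd, hz⟩ := h2
  set z : Submodule ℝ n := (derivedSeries ℝ n 1).toSubmodule with hzdef
  have hzspan : z = Submodule.span ℝ {m | ∃ x y : n, ⁅x, y⁆ = m} := by
    have : derivedSeries ℝ n 1 = ⁅(⊤ : LieIdeal ℝ n), (⊤ : LieIdeal ℝ n)⁆ := by
      simp
    rw [hzdef, this, LieSubmodule.lieIdeal_oper_eq_linear_span']
    congr 1
    ext m
    simp
  have hz' : finrank ℝ z = q * (q - 1) / 2 - 1 := hz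
  have hquot : finrank ℝ (n ⧸ z) = q := by
    have := Submodule.finrank_quotient_add_finrank z
    omega
  let b := finBasisOfFinrankEq ℝ (n ⧸ z) hquot
  let π : n →ₗ[ℝ] (Fin q → ℝ) := b.equivFun.toLinearMap ∘ₗ z.mkQ
  have hker : ∀ x, π x = 0 ↔ x ∈ z := by
    intro x
    simp [π]
  have hX : ∀ a, ∃ x, z.mkQ x = b a := fun a => z.mkQ_surjective _
  choose X hX using hX
  have πX : ∀ a, π (X a) = Pi.single a 1 := by
    intro a
    simp only [π, LinearMap.comp_apply, hX]
    ext c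
    simp [Pi.single_apply, eq_comm]
  have πbr : ∀ x y : n, π ⁅x, y⁆ = 0 := by
    intro x y
    rw [hker, hzspan]
    exact Submodule.subset_span ⟨x, y, rfl⟩
  have cen : ∀ x y : n, π x = 0 → ⁅x, y⁆ = 0 := by
    intro x y hx
    rw [hker, hzspan] at hx
    induction hx using Submodule.span_induction with
    | mem x h => obtain ⟨u, v, rfl⟩ := h; exact hn _ _ _
    | zero => simp
    | add x y _ _ h1 h2 => simp [h1, h2]
    | smul c x _ h => simp [h]
  have hexp := bracket_expand X π πX cen
  let T : skewMat q →ₗ[ℝ] n :=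
    { toFun := fun M => ∑ a, ∑ b, M.1 a b • ⁅X a, X b⁆
      map_add' := by
        intro M N
        simp [add_smul, Finset.sum_add_distrib]
      map_smul' := by
        intro c M
        simp [Finset.smul_sum, smul_smul] }
  have hrange : LinearMap.range T = z := by
    apply le_antisymm
    · rintro _ ⟨M, rfl⟩
      rw [← hker]
      simp [T, map_sum, πbr]
    · rw [hzspan, Submodule.span_le]
      rintro _ ⟨x, y, rfl⟩
      refine ⟨⟨fun a b => (π x a * π y b - π y a * π x b) / 2, ?_⟩, ?_⟩
      · intro a b; ring
      · change ∑ a, ∑ b, ((π x a * π y b - π y a * π x b) / 2) • ⁅X a, X b⁆ = _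
        have h1 := hexp x y
        have h2 := hexp y x
        have h3 : ⁅x, y⁆ = (1/2 : ℝ) • ⁅x, y⁆ - (1/2 : ℝ) • ⁅y, x⁆ := by
          rw [← lie_skew x y]; module
        rw [h3, h1, h2]
        simp only [Finset.smul_sum, ← Finset.sum_sub_distrib, smul_smul, ← sub_smul]
        refine Finset.sum_congr rfl fun a _ => Finset.sum_congr rfl fun b _ => ?_
        congr 1; ring
  have hk : finrank ℝ (LinearMap.ker T) = 1 := by
    have := T.finrank_range_add_finrank_ker
    rw [hrange, hz', finrank_skewMat] at this
    have hD : 1 ≤ q * (q - 1) / 2 := by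
      rw [Nat.le_div_iff_mul_le (by norm_num)]
      have : 1 ≤ q - 1 := by omega
      nlinarith
    omega
  obtain ⟨w, hw0, hw⟩ := ker_one T hk
  refine ⟨⟨X, π, w.1.1, πX, πbr, cen, w.1.2, ?_, w.2, ?_, ?_⟩⟩
  · intro h
    apply hw0
    ext1; ext1; exact h
  · intro M hM h0
    obtain ⟨t, ht⟩ := hw ⟨⟨M, hM⟩, h0⟩
    refine ⟨t, ?_⟩
    have := congrArg (fun v => v.1.1) ht
    exact this.symm
  · intro x hx
    rw [hker, ← hrange] at hx
    obtain ⟨M, hM⟩ := hx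
    exact ⟨M.1, M.2, hM⟩

/-- Normal form of a skew matrix under congruence. -/
lemma skew_normal {q : ℕ} (ω : Matrix (Fin q) (Fin q) ℝ) (skew : ∀ a b, ω b a = - ω a b) :
    ∃ (H K ω' : Matrix (Fin q) (Fin q) ℝ) (u : Fin q → ℝ), H * K = 1 ∧ K * H = 1 ∧
      ω = H * ω' * H.transpose ∧ (∀ a, u a = 0 ∨ u a = 1) ∧
      ω' * ω'.transpose = Matrix.diagonal u := by
  have hT : ω.transpose = -ω := by ext a b; simp [skew a b]
  have hpsd : (ω * ω.transpose).PosSemidef := by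
    simpa using Matrix.posSemidef_self_mul_conjTranspose ω
  have hS : (ω * ω.transpose).IsHermitian := hpsd.1
  let O : Matrix (Fin q) (Fin q) ℝ := hS.eigenvectorUnitary
  let d : Fin q → ℝ := hS.eigenvalues
  have hd : ∀ a, 0 ≤ d a := hpsd.eigenvalues_nonneg
  have hO1 : O * O.transpose = 1 := by
    have := (Matrix.mem_unitaryGroup_iff).1 hS.eigenvectorUnitary.2
    simpa [Matrix.star_eq_conjTranspose] using this
  have hO2 : O.transpose * O = 1 := by
    have := (Matrix.mem_unitaryGroup_iff').1 hS.eigenvectorUnitary.2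
    simpa [Matrix.star_eq_conjTranspose] using this
  have hspec : ω * ω.transpose = O * Matrix.diagonal d * O.transpose := by
    have := hS.spectral_theorem
    simpa [Unitary.conjStarAlgAut_apply, Matrix.star_eq_conjTranspose, Function.comp_def] using this
  let η := O.transpose * ω * O
  have hηT : η.transpose = -η := by
    simp [η, Matrix.transpose_mul, hT, Matrix.mul_assoc]
  have hηη : η * η.transpose = Matrix.diagonal d := by
    have : η * η.transpose = O.transpose * (ω * (O * O.transpose) * ω.transpose) * O := by
      simp [η, Matrix.transpose_mul, Matrix.mul_assoc]
    rw [this, hO1, Matrix.mul_one, hspec]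
    have : O.transpose * (O * Matrix.diagonal d * O.transpose) * O
      = (O.transpose * O) * Matrix.diagonal d * (O.transpose * O) := by
      simp only [Matrix.mul_assoc]
    rw [this, hO2]; simp
  have hcomm : η * Matrix.diagonal d = Matrix.diagonal d * η := by
    rw [← hηη, hηT]; simp [Matrix.mul_assoc]
  have hent : ∀ a b, η a b ≠ 0 → d a = d b := by
    intro a b h
    have := congrFun (congrFun hcomm a) b
    rw [Matrix.mul_diagonal, Matrix.diagonal_mul] at this
    have h2 : η a b * (d b - d a) = 0 := by linarith
    rcases mul_eq_zero.1 h2 with h3 | h3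
    · exact absurd h3 h
    · linarith
  let g : Fin q → ℝ := fun a => if d a = 0 then 1 else Real.sqrt (Real.sqrt (d a))
  have hg : ∀ a, g a ≠ 0 := by
    intro a
    by_cases h : d a = 0
    · simp [g, h]
    · have h1 : 0 < d a := lt_of_le_of_ne (hd a) (Ne.symm h)
      have : 0 < Real.sqrt (Real.sqrt (d a)) := Real.sqrt_pos.2 (Real.sqrt_pos.2 h1)
      simp only [g, h, if_false]
      exact this.ne'
  have hg4 : ∀ a, d a ≠ 0 → g a ^ 4 = d a := by
    intro a h
    simp only [g, h, if_false]
    have : ∀ x : ℝ, x ^ 4 = (x ^ 2) ^ 2 := fun x => by ring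
    rw [this, Real.sq_sqrt (Real.sqrt_nonneg _), Real.sq_sqrt (hd a)]
  have hgd : ∀ a b, d a = d b → g a = g b := by
    intro a b h
    simp only [g, h]
  refine ⟨O * Matrix.diagonal g, Matrix.diagonal (fun a => (g a)⁻¹) * O.transpose,
    Matrix.of (fun a b => (g a)⁻¹ * η a b * (g b)⁻¹), fun a => if d a = 0 then 0 else 1, ?_, ?_, ?_, ?_, ?_⟩
  · have : O * Matrix.diagonal g * (Matrix.diagonal (fun a => (g a)⁻¹) * O.transpose) =
      O * (Matrix.diagonal g * Matrix.diagonal (fun a => (g a)⁻¹)) * O.transpose := by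
      simp only [Matrix.mul_assoc]
    rw [this, Matrix.diagonal_mul_diagonal]
    simp [hg, hO1]
  · have : Matrix.diagonal (fun a => (g a)⁻¹) * O.transpose * (O * Matrix.diagonal g) =
      Matrix.diagonal (fun a => (g a)⁻¹) * (O.transpose * O) * Matrix.diagonal g := by
      simp only [Matrix.mul_assoc]
    rw [this, hO2, Matrix.mul_one, Matrix.diagonal_mul_diagonal]
    simp [hg]
  · have e : (Matrix.diagonal g * Matrix.of (fun a b => (g a)⁻¹ * η a b * (g b)⁻¹)
        * Matrix.diagonal g) = η := by
      ext a b
      rw [Matrix.mul_diagonal, Matrix.diagonal_mul, Matrix.of_apply]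
      have := hg a
      have := hg b
      field_simp
    have e2 : O * η * O.transpose = ω := by
      have : O * η * O.transpose = (O * O.transpose) * ω * (O * O.transpose) := by
        simp only [η, Matrix.mul_assoc]
      rw [this, hO1]; simp
    rw [Matrix.transpose_mul, Matrix.diagonal_transpose]
    conv_lhs => rw [← e2, ← e]
    simp only [Matrix.mul_assoc]
  · intro a
    by_cases h : d a = 0 <;> simp [h]
  · ext a b
    rw [Matrix.mul_apply]
    have h1 : ∀ c, (g a)⁻¹ * η a c * (g c)⁻¹ * ((g b)⁻¹ * η b c * (g c)⁻¹)
        = (g a)⁻¹ ^ 3 * (g b)⁻¹ * (η a c * η b c) := by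
      intro c
      by_cases h : η a c = 0
      · simp [h]
      · rw [← hgd a c (hent a c h)]; ring
    simp only [Matrix.transpose_apply, Matrix.of_apply, h1, ← Finset.mul_sum]
    have h2 : ∑ c, η a c * η b c = Matrix.diagonal d a b := by
      rw [← hηη, Matrix.mul_apply]; rfl
    rw [h2]
    by_cases hab : a = b
    · subst hab
      rw [Matrix.diagonal_apply_eq, Matrix.diagonal_apply_eq]
      by_cases h : d a = 0
      · simp [h]
      · have := hg4 a h
        have := hg a
        simp only [h, if_false]
        rw [← hg4 a h]
        field_simp
    · simp [Matrix.diagonal_apply_ne _ hab]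

lemma sum4_comm {N : Type} [AddCommMonoid N] {q : ℕ} (t : Fin q → Fin q → Fin q → Fin q → N) :
    ∑ c, ∑ d, ∑ b, ∑ a, t c d b a = ∑ a, ∑ b, ∑ d, ∑ c, t c d b a := by
  calc _ = ∑ c, ∑ b, ∑ d, ∑ a, t c d b a :=
        Finset.sum_congr rfl fun _ _ => Finset.sum_comm
    _ = ∑ c, ∑ b, ∑ a, ∑ d, t c d b a :=
        Finset.sum_congr rfl fun _ _ => Finset.sum_congr rfl fun _ _ => Finset.sum_comm
    _ = ∑ c, ∑ a, ∑ b, ∑ d, t c d b a :=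
        Finset.sum_congr rfl fun _ _ => Finset.sum_comm
    _ = ∑ a, ∑ c, ∑ b, ∑ d, t c d b a := Finset.sum_comm
    _ = ∑ a, ∑ b, ∑ c, ∑ d, t c d b a :=
        Finset.sum_congr rfl fun _ _ => Finset.sum_comm
    _ = _ :=
        Finset.sum_congr rfl fun _ _ => Finset.sum_congr rfl fun _ _ => Finset.sum_comm

lemma sum_cong {n : Type} [LieRing n] [LieAlgebra ℝ n] {q : ℕ}
    (X : Fin q → n) (H M : Matrix (Fin q) (Fin q) ℝ) :
    ∑ c, ∑ d, M c d • ⁅∑ a, H a c • X a, ∑ a, H a d • X a⁆ =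
      ∑ a, ∑ b, (H * M * H.transpose) a b • ⁅X a, X b⁆ := by
  simp only [sum_lie, lie_sum, smul_lie, lie_smul, smul_smul, Finset.smul_sum,
    Matrix.mul_apply, Matrix.transpose_apply, Finset.sum_mul, Finset.sum_smul]
  rw [sum4_comm]
  refine Finset.sum_congr rfl fun a _ => Finset.sum_congr rfl fun b _ =>
    Finset.sum_congr rfl fun c _ => Finset.sum_congr rfl fun d _ => ?_
  congr 1; ring

/-- One can normalize the frame. -/
lemma normalize_frame {n : Type} [LieRing n] [LieAlgebra ℝ n] {q : ℕ} (F : NilFrame n q) :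
    ∃ (F' : NilFrame n q) (u : Fin q → ℝ), (∀ a, u a = 0 ∨ u a = 1) ∧
      F'.ω * F'.ω.transpose = Matrix.diagonal u := by
  obtain ⟨H, K, ω', u, hHK, hKH, hω, hu, hd⟩ := skew_normal F.ω F.skew
  have hinv : ∀ M : Matrix (Fin q) (Fin q) ℝ, K * (H * M * H.transpose) * K.transpose = M := by
    intro M
    have : K * (H * M * H.transpose) * K.transpose = (K * H) * M * (K * H).transpose := by
      simp only [Matrix.transpose_mul, Matrix.mul_assoc]
    rw [this, hKH]; simp
  have hinv' : ∀ M : Matrix (Fin q) (Fin q) ℝ, H * (K * M * K.transpose) * H.transpose = M := by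
    intro M
    have : H * (K * M * K.transpose) * H.transpose = (H * K) * M * (H * K).transpose := by
      simp only [Matrix.transpose_mul, Matrix.mul_assoc]
    rw [this, hHK]; simp
  have hω' : ω' = K * F.ω * K.transpose := by rw [hω, hinv]
  have skT : ∀ M : Matrix (Fin q) (Fin q) ℝ, (∀ a b, M b a = - M a b) ↔ M.transpose = -M := by
    intro M
    constructor
    · intro h; ext a b; simp [h a b]
    · intro h a b
      have := congrFun (congrFun h a) b
      simpa using this
  have skc : ∀ P M : Matrix (Fin q) (Fin q) ℝ, (∀ a b, M b a = - M a b) →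
      ∀ a b, (P * M * P.transpose) b a = - (P * M * P.transpose) a b := by
    intro P M hM
    rw [skT] at hM ⊢
    simp [Matrix.transpose_mul, hM, Matrix.mul_assoc]
  have hπ0 : ∀ x, Matrix.mulVecLin K (F.π x) = 0 → F.π x = 0 := by
    intro x hx
    have := congrArg (fun v => H.mulVec v) hx
    simpa [Matrix.mulVec_mulVec, hHK] using this
  refine ⟨⟨fun c => ∑ a, H a c • F.X a, Matrix.mulVecLin K ∘ₗ F.π, ω', ?_, ?_, ?_, ?_, ?_, ?_, ?_,
    ?_⟩, u, hu, hd⟩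
  · intro c
    have e : F.π (∑ a, H a c • F.X a) = H.mulVec (Pi.single c 1) := by
      ext b
      simp [map_sum, F.πX, Pi.single_apply]
    rw [LinearMap.comp_apply, e, Matrix.mulVecLin_apply, Matrix.mulVec_mulVec, hKH,
      Matrix.one_mulVec]
  · intro x y; simp [F.πbr]
  · intro x y hx
    exact F.cen x y (hπ0 x hx)
  · rw [hω']; exact skc K _ F.skew
  · intro h
    apply F.ne
    rw [hω, h]; simp
  · rw [sum_cong, ← hω]; exact F.rel
  · intro M hM h0
    rw [sum_cong] at h0
    obtain ⟨t, ht⟩ := F.uniq _ (skc H M hM) h0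
    refine ⟨t, ?_⟩
    rw [← hinv M, ht, hω']; simp
  · intro x hx
    obtain ⟨M, hM, h⟩ := F.surj x (hπ0 x hx)
    refine ⟨K * M * K.transpose, skc K M hM, ?_⟩
    rw [sum_cong, hinv']; exact h

/-- The section of the bracket map. -/
lemma exists_section {n : Type} [LieRing n] [LieAlgebra ℝ n] {q : ℕ} (F : NilFrame n q) (m : ℝ)
    (hm : m ≠ 0) (hωm : ∑ a, ∑ b, F.ω a b * F.ω a b = m) :
    ∃ S : n →ₗ[ℝ] Matrix (Fin q) (Fin q) ℝ, (∀ x a b, S x b a = - S x a b) ∧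
      (∀ x, ∑ a, ∑ b, F.ω a b * S x a b = 0) ∧
      (∀ x, x = ∑ a, F.π x a • F.X a + (1/2 : ℝ) • ∑ a, ∑ b, S x a b • ⁅F.X a, F.X b⁆) ∧
      (∀ a, S (F.X a) = 0) ∧
      (∀ a b c d, S ⁅F.X a, F.X b⁆ c d = (if c = a ∧ d = b then 1 else 0)
        - (if c = b ∧ d = a then 1 else 0) - 2 / m * F.ω a b * F.ω c d) := by
  let K : Submodule ℝ (Matrix (Fin q) (Fin q) ℝ) :=
    { carrier := {M | (∀ a b, M b a = - M a b) ∧ ∑ a, ∑ b, F.ω a b * M a b = 0}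
      add_mem' := by
        rintro M N ⟨hM, hM'⟩ ⟨hN, hN'⟩
        refine ⟨fun a b => ?_, ?_⟩
        · simp only [Matrix.add_apply]; rw [hM a b, hN a b]; ring
        · simp [mul_add, Finset.sum_add_distrib, hM', hN']
      zero_mem' := by simp
      smul_mem' := by
        rintro c M ⟨hM, hM'⟩
        refine ⟨fun a b => ?_, ?_⟩
        · simp only [Matrix.smul_apply, smul_eq_mul]; rw [hM a b]; ring
        · simp only [Matrix.smul_apply, smul_eq_mul, mul_left_comm _ c, ← Finset.mul_sum, hM',
            mul_zero] }
  let T : Matrix (Fin q) (Fin q) ℝ →ₗ[ℝ] n :=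
    { toFun := fun M => (1/2 : ℝ) • ∑ a, ∑ b, M a b • ⁅F.X a, F.X b⁆
      map_add' := by
        intro M N
        simp [add_smul, Finset.sum_add_distrib]
      map_smul' := by
        intro c M
        simp only [Matrix.smul_apply, smul_eq_mul, mul_smul, ← Finset.smul_sum, RingHom.id_apply]
        rw [smul_comm] }
  have hT : ∀ M, T M = (1/2 : ℝ) • ∑ a, ∑ b, M a b • ⁅F.X a, F.X b⁆ := fun M => rfl
  have hTω : T F.ω = 0 := by rw [hT, F.rel, smul_zero]
  have hπT : ∀ M, F.π (T M) = 0 := by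
    intro M; simp [hT, map_sum, F.πbr]
  have hinj : LinearMap.ker (T ∘ₗ K.subtype) = ⊥ := by
    rw [LinearMap.ker_eq_bot']
    rintro ⟨M, hM, hM'⟩ h
    have h0 : T M = 0 := h
    rw [hT, smul_eq_zero] at h0
    obtain ⟨t, ht⟩ := F.uniq M hM (h0.resolve_left (by norm_num))
    subst ht
    simp only [Matrix.smul_apply, smul_eq_mul, mul_left_comm _ t, ← Finset.mul_sum, hωm] at hM'
    have : t = 0 := (mul_eq_zero.1 hM').resolve_right hm
    ext1
    simp [this]
  obtain ⟨g, hg⟩ := LinearMap.exists_leftInverse_of_injective _ hinj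
  have hg' : ∀ k : K, g (T k.1) = k := fun k => LinearMap.congr_fun hg k
  let p : n →ₗ[ℝ] n := LinearMap.id - ∑ a, (LinearMap.proj a ∘ₗ F.π).smulRight (F.X a)
  have hp : ∀ x, p x = x - ∑ a, F.π x a • F.X a := by
    intro x; simp [p, LinearMap.sum_apply]
  have hπp : ∀ x, F.π (p x) = 0 := by
    intro x
    rw [hp]; ext b
    simp [map_sum, F.πX, Pi.single_apply]
  have hpT : ∀ M, p (T M) = T M := by
    intro M; rw [hp, hπT]; simp
  have hproj : ∀ M : Matrix (Fin q) (Fin q) ℝ, (∀ a b, M b a = - M a b) →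
      M - ((∑ a, ∑ b, F.ω a b * M a b) / m) • F.ω ∈ K := by
    intro M hM
    refine ⟨fun a b => ?_, ?_⟩
    · simp only [Matrix.sub_apply, Matrix.smul_apply, smul_eq_mul]
      rw [hM a b, F.skew a b]; ring
    · simp only [Matrix.sub_apply, Matrix.smul_apply, smul_eq_mul, mul_sub,
        Finset.sum_sub_distrib]
      simp only [mul_left_comm (F.ω _ _), ← Finset.mul_sum, hωm]
      field_simp
      ring
  have hex : ∀ x, ∃ k : K, T k.1 = p x := by
    intro x
    obtain ⟨M, hM, h⟩ := F.surj (p x) (hπp x)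
    refine ⟨⟨_, hproj ((2 : ℝ) • M) ?_⟩, ?_⟩
    · intro a b
      simp only [Matrix.smul_apply, smul_eq_mul]
      rw [hM a b]; ring
    · rw [map_sub, map_smul T _ F.ω, hTω, smul_zero, sub_zero, map_smul, hT, h, smul_smul]
      norm_num
  refine ⟨K.subtype ∘ₗ g ∘ₗ p, ?_, ?_, ?_, ?_, ?_⟩
  · intro x; exact (g (p x)).2.1
  · intro x; exact (g (p x)).2.2
  · intro x
    obtain ⟨k, hk⟩ := hex x
    have h1 : (K.subtype ∘ₗ g ∘ₗ p) x = k.1 := by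
      change (g (p x)).1 = k.1
      rw [← hk, hg']
    rw [h1, ← hT, hk, hp]
    abel
  · intro a
    have : p (F.X a) = 0 := by
      rw [hp, F.πX]; simp [Pi.single_apply]
    simp [this]
  · intro a b c d
    let M : Matrix (Fin q) (Fin q) ℝ := Matrix.of fun c d => (if c = a ∧ d = b then 1 else 0)
        - (if c = b ∧ d = a then 1 else 0)
    have hM : ∀ c d, M d c = - M c d := by
      intro c d
      simp only [M, Matrix.of_apply, and_comm (a := d = a), and_comm (a := d = b)]
      ring
    have hs : ∑ c, ∑ d, F.ω c d * M c d = 2 * F.ω a b := by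
      simp only [M, Matrix.of_apply, mul_sub, Finset.sum_sub_distrib, ite_and, mul_ite, mul_one,
        mul_zero]
      simp
      rw [F.skew a b]; ring
    have hTM : T M = ⁅F.X a, F.X b⁆ := by
      rw [hT]
      simp only [M, Matrix.of_apply, sub_smul, Finset.sum_sub_distrib, ite_and, ite_smul, one_smul,
        zero_smul]
      simp
      rw [← lie_skew (F.X a) (F.X b)]; module
    have hk := hg' ⟨_, hproj M hM⟩
    have h2 : T (M - ((∑ a, ∑ b, F.ω a b * M a b) / m) • F.ω) = ⁅F.X a, F.X b⁆ := by
      rw [map_sub, map_smul, hTω, hTM]; simp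
    have h3 : (K.subtype ∘ₗ g ∘ₗ p) ⁅F.X a, F.X b⁆
        = M - ((∑ a, ∑ b, F.ω a b * M a b) / m) • F.ω := by
      change (g (p ⁅F.X a, F.X b⁆)).1 = _
      rw [← h2, hpT, hk]
    rw [h3, hs]
    simp only [M, Matrix.sub_apply, Matrix.smul_apply, Matrix.of_apply, smul_eq_mul]
    ring

lemma parseval {n : Type} [AddCommGroup n] [Module ℝ n] {ι : Type} [Fintype ι]
    (B : n →ₗ[ℝ] n →ₗ[ℝ] ℝ) (E : Basis ι ℝ n) (hE : IsONB (fun x y => B x y) E) (x : n) :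
    ∑ i, B (E i) x • E i = x := by
  classical
  have : ∀ i, B (E i) x = E.repr x i := by
    intro i
    conv_lhs => rw [← E.sum_repr x]
    rw [map_sum, Finset.sum_eq_single i]
    · have h : B (E i) (E i) = 1 := (hE i i).1 rfl
      rw [map_smul, h]; simp
    · intro j _ hj
      have h : B (E i) (E j) = 0 := (hE i j).2 hj.symm
      rw [map_smul, h]; simp
    · simp
  simp only [this]
  exact E.sum_repr x

lemma onb_sum {n : Type} [LieRing n] [LieAlgebra ℝ n] {q : ℕ} (F : NilFrame n q)
    (B : n →ₗ[ℝ] n →ₗ[ℝ] ℝ) (hB : ∀ x a, B x (F.X a) = F.π x a)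
    {ι : Type} [Fintype ι] (E : Basis ι ℝ n) (hE : IsONB (fun x y => B x y) E)
    (L : n →ₗ[ℝ] n →ₗ[ℝ] ℝ) (hL : ∀ x y, F.π y = 0 → L x y = 0) :
    ∑ i, L (E i) (E i) = ∑ a, L (F.X a) (F.X a) := by
  have h1 : ∀ x y, L x y = ∑ a, F.π y a * L x (F.X a) := by
    intro x y
    have : F.π (y - ∑ a, F.π y a • F.X a) = 0 := by
      ext b; simp [map_sum, F.πX, Pi.single_apply]
    have := hL x _ this
    rw [map_sub, map_sum, sub_eq_zero] at this
    rw [this]; simp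
  calc _ = ∑ i, ∑ a, F.π (E i) a * L (E i) (F.X a) := Finset.sum_congr rfl fun i _ => h1 _ _
    _ = ∑ a, ∑ i, F.π (E i) a * L (E i) (F.X a) := Finset.sum_comm
    _ = _ := by
      refine Finset.sum_congr rfl fun a _ => ?_
      have : L (F.X a) (F.X a) = L (∑ i, B (E i) (F.X a) • E i) (F.X a) := by
        rw [parseval B E hE (F.X a)]
      rw [this, map_sum]
      simp [LinearMap.sum_apply, hB]

lemma two_le_sum {q : ℕ} (u : Fin q → ℝ) (hu : ∀ a, 0 ≤ u a) {c d : Fin q} (h : c ≠ d) :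
    u c + u d ≤ ∑ a, u a := by
  rw [← Finset.sum_pair h]
  exact Finset.sum_le_sum_of_subset_of_nonneg (Finset.subset_univ _) fun a _ _ => hu a

/-- Trace formula. -/
lemma trace_formula {n : Type} [LieRing n] [LieAlgebra ℝ n] [FiniteDimensional ℝ n]
    {q : ℕ} (F : NilFrame n q)
    (S : n →ₗ[ℝ] Matrix (Fin q) (Fin q) ℝ)
    (S3 : ∀ x, x = ∑ a, F.π x a • F.X a + (1/2 : ℝ) • ∑ a, ∑ b, S x a b • ⁅F.X a, F.X b⁆)
    (M : n →ₗ[ℝ] n) :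
    trace ℝ n M = ∑ a, F.π (M (F.X a)) a + 1/2 * ∑ a, ∑ b, S (M ⁅F.X a, F.X b⁆) a b := by
  let σ : Fin q → Fin q → n →ₗ[ℝ] ℝ := fun a b =>
    { toFun := fun x => S x a b
      map_add' := by intro x y; simp
      map_smul' := by intro c x; simp }
  have hM : M = ∑ a, (LinearMap.proj a ∘ₗ F.π).smulRight (M (F.X a)) +
      (1/2 : ℝ) • ∑ a, ∑ b, (σ a b).smulRight (M ⁅F.X a, F.X b⁆) := by
    ext x
    conv_lhs => rw [S3 x]
    simp [map_sum, LinearMap.sum_apply, σ]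
  conv_lhs => rw [hM]
  simp only [map_add, map_sum, map_smul, LinearMap.trace_smulRight]
  simp [σ]

theorem frame_einstein {n : Type} [LieRing n] [LieAlgebra ℝ n] [FiniteDimensional ℝ n]
    {q : ℕ} (hq : 2 ≤ q) (F : NilFrame n q) (u : Fin q → ℝ) (hu : ∀ a, u a = 0 ∨ u a = 1)
    (hd : F.ω * F.ω.transpose = Matrix.diagonal u) : IsEinsteinNilradical n := by
  have hωω : ∀ a b, ∑ c, F.ω a c * F.ω b c = if a = b then u a else 0 := by
    intro a b
    have := congrFun (congrFun hd a) b
    rw [Matrix.mul_apply, Matrix.diagonal_apply] at this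
    exact this
  have hu0 : ∀ a, 0 ≤ u a := fun a => by rcases hu a with h | h <;> rw [h] <;> norm_num
  have hu1 : ∀ a, 0 ≤ 1 - u a := fun a => by rcases hu a with h | h <;> rw [h] <;> norm_num
  have hone : ∀ a b, F.ω a b ≠ 0 → u a = 1 := by
    intro a b h
    refine (hu a).resolve_left fun h0 => ?_
    have h1 := hωω a a
    rw [if_pos rfl, h0] at h1
    have := (Finset.sum_eq_zero_iff_of_nonneg (fun c _ => mul_self_nonneg (F.ω a c))).1 h1 b
      (Finset.mem_univ b)
    exact h (mul_self_eq_zero.1 this)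
  have hone' : ∀ a b, F.ω a b ≠ 0 → u b = 1 := by
    intro a b h
    apply hone b a
    rw [F.skew a b]; exact neg_ne_zero.2 h
  obtain ⟨m, hm⟩ : ∃ m : ℝ, m = ∑ a, u a := ⟨_, rfl⟩
  have hm2 : 2 ≤ m := by
    have : ∃ a b, F.ω a b ≠ 0 := by
      by_contra! hcon
      exact F.ne (by ext a b; simp [hcon a b])
    obtain ⟨a, b, hab⟩ := this
    have hne : a ≠ b := by
      rintro rfl
      have := F.skew a a
      apply hab; linarith
    have := two_le_sum u hu0 hne
    rw [hone a b hab, hone' a b hab] at this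
    linarith
  have hωm : ∑ a, ∑ b, F.ω a b * F.ω a b = m := by
    rw [hm]; exact Finset.sum_congr rfl fun a _ => by rw [hωω]; simp
  have hm0 : m ≠ 0 := by linarith
  obtain ⟨S, S1, S2, S3, S4, S5⟩ := exists_section F m hm0 hωm
  have hqr : (2 : ℝ) ≤ q := by exact_mod_cast hq
  -- constants
  obtain ⟨κ, hκ⟩ : ∃ κ : ℝ, κ = m * (q - 1) / 2 - 2 := ⟨_, rfl⟩
  obtain ⟨t, ht⟩ : ∃ t : ℝ, t = ((2 * q - 1) * κ + 2 * m) / 2 := ⟨_, rfl⟩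
  have htpos : 0 < t := by
    rw [ht, hκ]
    nlinarith [mul_nonneg (sub_nonneg.2 hm2) (sub_nonneg.2 hqr),
      mul_nonneg (mul_nonneg (sub_nonneg.2 hm2) (sub_nonneg.2 hqr)) (sub_nonneg.2 hqr),
      sq_nonneg ((q : ℝ) - 7/4)]
  let w : Fin q → Fin q → ℝ := fun c d => κ + u c + u d
  have hw : ∀ c d, w c d = κ + u c + u d := fun _ _ => rfl
  have hwpos : ∀ c d, c ≠ d → 0 < w c d := by
    intro c d h
    have := two_le_sum (fun a => 1 - u a) hu1 h
    simp only [Finset.sum_sub_distrib, ← hm, Finset.sum_const, Finset.card_univ, Fintype.card_fin,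
      nsmul_eq_mul, mul_one] at this
    rw [hw, hκ]
    nlinarith [mul_nonneg (sub_nonneg.2 hm2) (sub_nonneg.2 hqr)]
  have hwω : ∀ a b, w a b * F.ω a b = (κ + 2) * F.ω a b := by
    intro a b
    by_cases h : F.ω a b = 0
    · simp [h]
    · rw [hw, hone a b h, hone' a b h]; ring
  let l : Fin q → ℝ := fun a => (κ + 2 * u a + 2 * t) / 4
  have hl : ∀ a, l a = (κ + 2 * u a + 2 * t) / 4 := fun _ => rfl
  have hlω : ∀ a b, F.ω a b * (l a + l b) = F.ω a b * ((κ / 2 + 1 + t)) := by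
    intro a b
    by_cases h : F.ω a b = 0
    · simp [h]
    · rw [hl, hl, hone a b h, hone' a b h]; ring
  -- inner product
  let B : n →ₗ[ℝ] n →ₗ[ℝ] ℝ := LinearMap.mk₂ ℝ
    (fun x y => ∑ a, F.π x a * F.π y a + 1/2 * ∑ c, ∑ d, w c d * (S x c d * S y c d))
    (by intro x x' y
        simp only [map_add, Pi.add_apply, Matrix.add_apply, add_mul, mul_add,
          Finset.sum_add_distrib]
        ring)
    (by intro c x y
        simp only [map_smul, Pi.smul_apply, Matrix.smul_apply, smul_eq_mul, mul_assoc,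
          mul_left_comm _ c, ← Finset.mul_sum, ← mul_add])
    (by intro x x' y
        simp only [map_add, Pi.add_apply, Matrix.add_apply, mul_add,
          Finset.sum_add_distrib]
        ring)
    (by intro c x y
        simp only [map_smul, Pi.smul_apply, Matrix.smul_apply, smul_eq_mul,
          mul_left_comm _ c, ← Finset.mul_sum, ← mul_add])
  have hB : ∀ x y, B x y = ∑ a, F.π x a * F.π y a
      + 1/2 * ∑ c, ∑ d, w c d * (S x c d * S y c d) := fun _ _ => rfl
  have hBX : ∀ x a, B x (F.X a) = F.π x a := by
    intro x a
    rw [hB, S4, F.πX]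
    simp [Pi.single_apply]
  have hBbr : ∀ x a b, B x ⁅F.X a, F.X b⁆ = w a b * S x a b := by
    intro x a b
    rw [hB, F.πbr]
    have e : ∀ c d, w c d * (S x c d * S ⁅F.X a, F.X b⁆ c d) =
        (if c = a then if d = b then w c d * S x c d else 0 else 0)
        - (if c = b then if d = a then w c d * S x c d else 0 else 0)
        - (2 / m * F.ω a b * (κ + 2)) * (F.ω c d * S x c d) := by
      intro c d
      have h := hwω c d
      have : w c d * (S x c d * S ⁅F.X a, F.X b⁆ c d) =
        (if c = a then if d = b then w c d * S x c d else 0 else 0)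
        - (if c = b then if d = a then w c d * S x c d else 0 else 0)
        - (2 / m * F.ω a b) * (w c d * F.ω c d) * S x c d := by
        rw [S5]
        simp only [ite_and]
        split_ifs <;> ring
      rw [this, h]; ring
    simp only [e, Finset.sum_sub_distrib, ← Finset.mul_sum, S2]
    simp
    rw [S1 x a b]
    simp only [hw]; ring
  have hexp := bracket_expand F.X F.π F.πX F.cen
  -- the key sum
  have hkey : ∀ x a, ∑ b, w a b * S ⁅x, F.X b⁆ a b = 2 * (t - l a) * F.π x a := by
    intro x a
    have e1 : ∀ b, S ⁅x, F.X b⁆ a b = F.π x a - (if a = b then F.π x a else 0)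
        - 2 / m * F.ω a b * ∑ c, F.π x c * F.ω c b := by
      intro b
      have h1 : ⁅x, F.X b⁆ = ∑ c, F.π x c • ⁅F.X c, F.X b⁆ := by
        rw [hexp x (F.X b)]
        refine Finset.sum_congr rfl fun c _ => ?_
        rw [F.πX]; simp [Pi.single_apply]
      rw [h1, map_sum, Matrix.sum_apply]
      simp only [map_smul, Matrix.smul_apply, smul_eq_mul, S5, mul_sub, Finset.sum_sub_distrib,
        ite_and]
      have h2 : ∑ c, F.π x c * (2 / m * F.ω c b * F.ω a b)
          = 2 / m * F.ω a b * ∑ c, F.π x c * F.ω c b := by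
        rw [Finset.mul_sum]; exact Finset.sum_congr rfl fun c _ => by ring
      rw [h2]
      by_cases hab : a = b
      · subst hab; simp
      · simp [hab]
    have e2 : ∀ b, w a b * S ⁅x, F.X b⁆ a b = w a b * F.π x a
        - (if a = b then w a b * F.π x a else 0)
        - 2 / m * (κ + 2) * ∑ c, F.π x c * (F.ω c b * F.ω a b) := by
      intro b
      have h := hwω a b
      have h3 : ∑ c, F.π x c * (F.ω c b * F.ω a b) = F.ω a b * ∑ c, F.π x c * F.ω c b := by
        rw [Finset.mul_sum]; exact Finset.sum_congr rfl fun c _ => by ring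
      rw [e1, h3]
      have : 2 / m * (κ + 2) * (F.ω a b * ∑ c, F.π x c * F.ω c b)
        = 2 / m * (w a b * F.ω a b) * ∑ c, F.π x c * F.ω c b := by rw [h]; ring
      rw [this]
      split_ifs <;> ring
    have e3 : ∑ b, ∑ c, F.π x c * (F.ω c b * F.ω a b) = F.π x a * u a := by
      rw [Finset.sum_comm]
      simp only [← Finset.mul_sum, hωω]
      simp
    have e4 : ∑ b, w a b = q * (κ + u a) + m := by
      simp only [hw, Finset.sum_add_distrib, ← hm, Finset.sum_const, Finset.card_univ,
        Fintype.card_fin, nsmul_eq_mul]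
      ring
    simp only [e2, Finset.sum_sub_distrib, ← Finset.mul_sum, ← Finset.sum_mul, e3, e4]
    simp only [Finset.sum_ite_eq, Finset.mem_univ, if_true, hw, hl]
    have e5 : 2 / m * (κ + 2) = q - 1 := by rw [hκ]; field_simp; ring
    rw [e5, ht]; ring
  have hkey' : ∀ y b, ∑ a, w a b * S ⁅F.X a, y⁆ a b = 2 * (t - l b) * F.π y b := by
    intro y b
    rw [← hkey y b]
    refine Finset.sum_congr rfl fun a _ => ?_
    rw [← lie_skew, map_neg, Matrix.neg_apply, S1 _ b a, hw, hw]
    ring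
  -- the derivation
  let P : n →ₗ[ℝ] n :=
    { toFun := fun x => ∑ a, F.π x a • (l a • F.X a) +
        (1/2 : ℝ) • ∑ a, ∑ b, S x a b • ((l a + l b) • ⁅F.X a, F.X b⁆)
      map_add' := by
        intro x y
        simp only [map_add, Pi.add_apply, Matrix.add_apply, add_smul _ _ (_ • _),
          Finset.sum_add_distrib, smul_add]
        abel
      map_smul' := by
        intro c x
        simp only [map_smul, Pi.smul_apply, Matrix.smul_apply, smul_eq_mul, mul_smul c,
          ← Finset.smul_sum, RingHom.id_apply, smul_add]
        rw [smul_comm c (1/2 : ℝ)] }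
  have hP : ∀ x, P x = ∑ a, F.π x a • (l a • F.X a) +
        (1/2 : ℝ) • ∑ a, ∑ b, S x a b • ((l a + l b) • ⁅F.X a, F.X b⁆) := fun _ => rfl
  have hPX : ∀ a, P (F.X a) = l a • F.X a := by
    intro a
    rw [hP, S4, F.πX]
    simp [Pi.single_apply]
  have hPbr : ∀ a b, P ⁅F.X a, F.X b⁆ = (l a + l b) • ⁅F.X a, F.X b⁆ := by
    intro a b
    rw [hP, F.πbr]
    have e : ∀ c d, S ⁅F.X a, F.X b⁆ c d • ((l c + l d) • ⁅F.X c, F.X d⁆) =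
        (if c = a then if d = b then (l c + l d) • ⁅F.X c, F.X d⁆ else 0 else 0)
        - (if c = b then if d = a then (l c + l d) • ⁅F.X c, F.X d⁆ else 0 else 0)
        - (2 / m * F.ω a b * (κ / 2 + 1 + t)) • (F.ω c d • ⁅F.X c, F.X d⁆) := by
      intro c d
      have h := hlω c d
      have h1 : (2 / m * F.ω a b * (κ / 2 + 1 + t)) • (F.ω c d • ⁅F.X c, F.X d⁆)
          = (2 / m * F.ω a b * (F.ω c d * (l c + l d))) • ⁅F.X c, F.X d⁆ := by
        rw [h, smul_smul]; congr 1; ring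
      rw [h1, S5]
      simp only [ite_and]
      split_ifs <;> module
    simp only [e, Finset.sum_sub_distrib, ← Finset.smul_sum, F.rel]
    simp
    rw [← lie_skew (F.X a) (F.X b)]; module
  have hπP : ∀ x a, F.π (P x) a = l a * F.π x a := by
    intro x a
    rw [hP]
    simp [map_sum, F.πX, F.πbr, Pi.single_apply, mul_comm]
  let Φ : LieDerivation ℝ n n :=
    { toLinearMap := P
      leibniz' := by
        intro x y
        rw [← lie_skew y (P x), sub_neg_eq_add, hexp x y, hexp x (P y), hexp (P x) y]
        simp only [map_sum, map_smul, hPbr, hπP, ← Finset.sum_add_distrib, smul_smul, ← add_smul]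
        refine Finset.sum_congr rfl fun a _ => Finset.sum_congr rfl fun b _ => ?_
        congr 1; ring }
  have hΦ : (Φ : n →ₗ[ℝ] n) = P := rfl
  refine ⟨fun x y => B x y, ⟨?_, ?_, ?_⟩, Φ, -t, by linarith, ?_⟩
  · intro x y
    change B x y = B y x
    rw [hB, hB]
    simp only [mul_comm (F.π x _), mul_comm (S x _ _)]
  · intro a x x' y
    simp
  · intro x hx
    change 0 < B x x
    have hSd : ∀ c, S x c c = 0 := fun c => by have := S1 x c c; linarith
    have hnn : ∀ c d, 0 ≤ w c d * (S x c d * S x c d) := by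
      intro c d
      by_cases h : c = d
      · subst h; simp [hSd]
      · exact mul_nonneg (hwpos c d h).le (mul_self_nonneg _)
    have hs1 : 0 ≤ ∑ a, F.π x a * F.π x a := Finset.sum_nonneg fun a _ => mul_self_nonneg _
    have hs2 : 0 ≤ ∑ c, ∑ d, w c d * (S x c d * S x c d) :=
      Finset.sum_nonneg fun c _ => Finset.sum_nonneg fun d _ => hnn c d
    rw [hB]
    by_contra hcon
    have z1 : ∑ a, F.π x a * F.π x a = 0 := by linarith
    have z2 : ∑ c, ∑ d, w c d * (S x c d * S x c d) = 0 := by linarith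
    apply hx
    have p1 : ∀ a, F.π x a = 0 := fun a => mul_self_eq_zero.1
      ((Finset.sum_eq_zero_iff_of_nonneg (fun a _ => mul_self_nonneg _)).1 z1 a
        (Finset.mem_univ a))
    have p2 : ∀ c d, S x c d = 0 := by
      intro c d
      by_cases h : c = d
      · subst h; exact hSd c
      · have q1 := (Finset.sum_eq_zero_iff_of_nonneg
          (fun c _ => Finset.sum_nonneg fun d _ => hnn c d)).1 z2 c (Finset.mem_univ c)
        have q2 := (Finset.sum_eq_zero_iff_of_nonneg
          (fun d _ => hnn c d)).1 q1 d (Finset.mem_univ d)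
        exact mul_self_eq_zero.1 ((mul_eq_zero.1 q2).resolve_left (hwpos c d h).ne')
    rw [S3 x]
    simp [p1, p2]
  · intro ι _ E hE A
    have cen' : ∀ x y : n, F.π y = 0 → ⁅x, y⁆ = 0 := by
      intro x y h
      rw [← lie_skew, F.cen y x h, neg_zero]
    -- reduce the right hand side to the frame
    have hred : ricRHS (fun x y => B x y) E A = ∑ a, ∑ b,
        B (A ⁅F.X a, F.X b⁆ - ⁅A (F.X a), F.X b⁆ - ⁅F.X a, A (F.X b)⁆) ⁅F.X a, F.X b⁆ := by
      have s1 : ∀ x, ∑ j, B (A ⁅x, E j⁆ - ⁅A x, E j⁆ - ⁅x, A (E j)⁆) ⁅x, E j⁆ =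
          ∑ b, B (A ⁅x, F.X b⁆ - ⁅A x, F.X b⁆ - ⁅x, A (F.X b)⁆) ⁅x, F.X b⁆ := by
        intro x
        refine onb_sum F B hBX E hE (LinearMap.mk₂ ℝ
          (fun y y' => B (A ⁅x, y⁆ - ⁅A x, y⁆ - ⁅x, A y⁆) ⁅x, y'⁆) ?_ ?_ ?_ ?_) ?_
        · intro y z y'
          simp only [lie_add, map_add, map_sub, LinearMap.add_apply, LinearMap.sub_apply]; ring
        · intro c y y'
          simp only [lie_smul, map_smul, map_sub, LinearMap.smul_apply, LinearMap.sub_apply,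
            smul_eq_mul]; ring
        · intro y z y'
          simp only [lie_add, map_add]
        · intro c y y'
          simp only [lie_smul, map_smul]
        · intro y y' h
          rw [LinearMap.mk₂_apply, cen' _ _ h, map_zero]
      have s2 : ∀ y, ∑ i, B (A ⁅E i, y⁆ - ⁅A (E i), y⁆ - ⁅E i, A y⁆) ⁅E i, y⁆ =
          ∑ a, B (A ⁅F.X a, y⁆ - ⁅A (F.X a), y⁆ - ⁅F.X a, A y⁆) ⁅F.X a, y⁆ := by
        intro y
        refine onb_sum F B hBX E hE (LinearMap.mk₂ ℝ
          (fun x x' => B (A ⁅x, y⁆ - ⁅A x, y⁆ - ⁅x, A y⁆) ⁅x', y⁆) ?_ ?_ ?_ ?_) ?_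
        · intro x z x'
          simp only [add_lie, map_add, map_sub, LinearMap.add_apply, LinearMap.sub_apply]; ring
        · intro c x x'
          simp only [smul_lie, map_smul, map_sub, LinearMap.smul_apply, LinearMap.sub_apply,
            smul_eq_mul]; ring
        · intro x z x'
          simp only [add_lie, map_add]
        · intro c x x'
          simp only [smul_lie, map_smul]
        · intro x x' h
          rw [LinearMap.mk₂_apply, F.cen _ _ h, map_zero]
      unfold ricRHS
      simp only [s1]
      rw [Finset.sum_comm]
      simp only [s2]
      rw [Finset.sum_comm]
    have hr2 : ricRHS (fun x y => B x y) E A = ∑ a, ∑ b, w a b * S (A ⁅F.X a, F.X b⁆) a b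
        - ∑ a, 4 * (t - l a) * F.π (A (F.X a)) a := by
      rw [hred]
      simp only [hBbr]
      have c0 : ∀ a b, w a b * S (A ⁅F.X a, F.X b⁆ - ⁅A (F.X a), F.X b⁆ - ⁅F.X a, A (F.X b)⁆) a b
          = w a b * S (A ⁅F.X a, F.X b⁆) a b - w a b * S ⁅A (F.X a), F.X b⁆ a b
            - w a b * S ⁅F.X a, A (F.X b)⁆ a b := by
        intro a b
        rw [map_sub, map_sub, Matrix.sub_apply, Matrix.sub_apply]; ring
      simp only [c0, Finset.sum_sub_distrib]
      have c1 : ∑ a, ∑ b, w a b * S ⁅F.X a, A (F.X b)⁆ a b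
          = ∑ b, 2 * (t - l b) * F.π (A (F.X b)) b := by
        rw [Finset.sum_comm]
        exact Finset.sum_congr rfl fun b _ => hkey' _ _
      rw [c1]
      simp only [hkey, sub_sub, ← Finset.sum_sub_distrib]
      exact Finset.sum_congr rfl fun b _ => by ring
    rw [hr2, LinearMap.trace_comp_comm', trace_formula F S S3, hΦ]
    have d1 : ∀ a, F.π ((A ∘ₗ ((-t) • LinearMap.id + P)) (F.X a)) a
        = - (t - l a) * F.π (A (F.X a)) a := by
      intro a
      simp only [LinearMap.comp_apply, LinearMap.add_apply, LinearMap.smul_apply,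
        LinearMap.id_apply, hPX, ← add_smul, map_smul, Pi.smul_apply, smul_eq_mul]
      ring
    have d2 : ∀ a b, S ((A ∘ₗ ((-t) • LinearMap.id + P)) ⁅F.X a, F.X b⁆) a b
        = 1/2 * (w a b * S (A ⁅F.X a, F.X b⁆) a b) := by
      intro a b
      simp only [LinearMap.comp_apply, LinearMap.add_apply, LinearMap.smul_apply,
        LinearMap.id_apply, hPbr, ← add_smul, map_smul, Matrix.smul_apply, smul_eq_mul, hw, hl]
      ring
    simp only [d1, d2, ← Finset.mul_sum, mul_assoc, neg_mul, Finset.sum_neg_distrib]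
    ring

/-- Lemma 6.4: every two-step nilpotent Lie algebra of type `(D-1, q)`, where
`D = q(q-1)/2`, is an Einstein nilradical. -/
theorem einsteinNilradical_of_type_D_sub_one (q : ℕ) (hq : 2 ≤ q)
    (n : Type) [LieRing n] [LieAlgebra ℝ n] [FiniteDimensional ℝ n]
    (h2 : IsTwoStepOfType n (q * (q - 1) / 2 - 1) q) :
    IsEinsteinNilradical n := by
  obtain ⟨F⟩ := exists_frame q hq n h2
  obtain ⟨F', u, hu, hd⟩ := normalize_frame F
  exact frame_einstein hq F' u hu hd
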